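/- Let P ∈ ℂ[X_1,…,X_n] be a reduced (squarefree) polynomial which is X_1-generic, with factorization P = P_1 ⋯ P_s into s distinct irreducible factors. Then the image Ē(P) of E(P) in the quotient ring Q(P) = ℂ[X_1,…,X_n]/(P) is a ℂ-vector space of dimension exactly s. -/

import Mathlib

open MvPolynomial

/-- A polynomial `P ∈ ℂ[X_1,…,X_{n+1}]` (variable `0` playing the role of `X_1`)
is `X_1`-generic if the projection forgetting the first coordinate, restricted to
the hypersurface `V(P)`, has finite fibers: for every `b ∈ ℂⁿ` the set
`{t ∈ ℂ : P(t, b) = 0}` is finite. -/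
def IsX1Generic (n : ℕ) (P : MvPolynomial (Fin (n + 1)) ℂ) : Prop :=
  ∀ b : Fin n → ℂ, {t : ℂ | eval (Fin.cons t b) P = 0}.Finite


/-- The space `F(P)` for `P ∈ ℂ[X_1,…,X_n]`: tuples `A = (A_1,…,A_n)` with
`P·(∂A_j/∂X_i − ∂A_i/∂X_j) = A_j·(∂P/∂X_i) − A_i·(∂P/∂X_j)` for all `i < j`
(closedness of the rational 1-form `ω(A) = Σ_i (A_i/P) dX_i`), subject to the
multidegree bounds `deg_{X_i} A_i ≤ m_i − 1` and `deg_{X_j} A_i ≤ m_j` for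
`j ≠ i`, where `m_i = deg_{X_i} P`. -/
noncomputable def ruppertGaoSpace (n : ℕ) (P : MvPolynomial (Fin n) ℂ) :
    Submodule ℂ (Fin n → MvPolynomial (Fin n) ℂ) where
  carrier := { A | (∀ i j : Fin n, i < j →
        P * (pderiv i (A j) - pderiv j (A i)) = A j * pderiv i P - A i * pderiv j P) ∧
      (∀ i : Fin n, degreeOf i (A i) ≤ degreeOf i P - 1) ∧
      (∀ i j : Fin n, j ≠ i → degreeOf j (A i) ≤ degreeOf j P) }
  add_mem' := by
    rintro A B ⟨h₁, d₁, d₂⟩ ⟨h₁', d₁', d₂'⟩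
    refine ⟨fun i j hij => ?_, fun i => ?_, fun i j hij => ?_⟩
    · simp only [Pi.add_apply, map_add]
      linear_combination h₁ i j hij + h₁' i j hij
    · exact le_trans (MvPolynomial.degreeOf_add_le _ _ _) (max_le (d₁ i) (d₁' i))
    · exact le_trans (MvPolynomial.degreeOf_add_le _ _ _) (max_le (d₂ i j hij) (d₂' i j hij))
  zero_mem' :=
    ⟨fun i j hij => by simp, fun i => by simp, fun i j hij => by simp⟩
  smul_mem' := by
    rintro c A ⟨h₁, d₁, d₂⟩
    refine ⟨fun i j hij => ?_, fun i => ?_, fun i j hij => ?_⟩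
    · simp only [Pi.smul_apply, smul_eq_C_mul, pderiv_C_mul]
      linear_combination (C c : MvPolynomial (Fin n) ℂ) * h₁ i j hij
    · simpa [smul_eq_C_mul] using
        le_trans (MvPolynomial.degreeOf_C_mul_le (A i) i c) (d₁ i)
    · simpa [smul_eq_C_mul] using
        le_trans (MvPolynomial.degreeOf_C_mul_le (A i) j c) (d₂ i j hij)

namespace RuppertGao

theorem degreeOf_pderiv_le {σ R : Type*} [CommSemiring R] (i j : σ) (p : MvPolynomial σ R) :
    degreeOf j (pderiv i p) ≤ degreeOf j p := by
  classical
  refine degreeOf_le_iff.2 fun m hm => ?_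
  rw [mem_support_iff, coeff_pderiv] at hm
  have := monomial_le_degreeOf j (mem_support_iff.2 (left_ne_zero_of_mul hm))
  exact le_trans (by simp) this

theorem degreeOf_pderiv_self_le {σ R : Type*} [CommSemiring R] (i : σ) (p : MvPolynomial σ R) :
    degreeOf i (pderiv i p) ≤ degreeOf i p - 1 := by
  classical
  refine degreeOf_le_iff.2 fun m hm => ?_
  rw [mem_support_iff, coeff_pderiv] at hm
  have := monomial_le_degreeOf i (mem_support_iff.2 (left_ne_zero_of_mul hm))
  simp at this
  omega

theorem pderiv_eq_zero_iff {σ R : Type*} [CommSemiring R] [NoZeroDivisors R] [CharZero R]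
    {i : σ} {p : MvPolynomial σ R} : pderiv i p = 0 ↔ i ∉ p.vars := by
  classical
  refine ⟨fun h hi => ?_, pderiv_eq_zero_of_notMem_vars⟩
  obtain ⟨m, hm, hi⟩ := mem_vars_iff_mem_support i |>.1 hi
  have hle : Finsupp.single i 1 ≤ m := by
    simpa [Finsupp.single_le_iff, Nat.one_le_iff_ne_zero] using hi
  have := congrArg (coeff (m - Finsupp.single i 1)) h
  rw [coeff_pderiv, tsub_add_cancel_of_le hle, coeff_zero] at this
  exact (mul_eq_zero.1 this).elim (mem_support_iff.1 hm) (Nat.cast_add_one_ne_zero _)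

theorem totalDegree_pderiv_lt {σ R : Type*} [CommSemiring R] {i : σ} {p : MvPolynomial σ R}
    (h : pderiv i p ≠ 0) : (pderiv i p).totalDegree < p.totalDegree := by
  classical
  have key : ∀ m ∈ (pderiv i p).support, (m.sum fun _ e => e) + 1 ≤ p.totalDegree := by
    intro m hm
    rw [mem_support_iff, coeff_pderiv] at hm
    have := le_totalDegree (mem_support_iff.2 (left_ne_zero_of_mul hm))
    rwa [Finsupp.sum_add_index' (by simp) (by simp), Finsupp.sum_single_index rfl] at this
  obtain ⟨m, hm⟩ := support_nonempty.2 h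
  have h0 := key m hm
  have : (pderiv i p).totalDegree ≤ p.totalDegree - 1 :=
    Finset.sup_le fun m hm => Nat.le_sub_one_of_lt (key m hm)
  omega

theorem derivation_aeval {σ k L : Type*} [Fintype σ] [CommRing k] [CommRing L] [Algebra k L]
    (D : Derivation k L L) (x : σ → L) (p : MvPolynomial σ k) :
    D (aeval x p) = ∑ i, aeval x (pderiv i p) * D (x i) := by
  classical
  induction p using MvPolynomial.induction_on with
  | C a => simp
  | add p q hp hq => simp [hp, hq, add_mul, Finset.sum_add_distrib]
  | mul_X p i hp =>
    simp only [map_mul, aeval_X, Derivation.leibniz, hp, smul_eq_mul, map_add, add_mul,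
      Finset.sum_add_distrib, pderiv_X, Finset.mul_sum]
    congr 1
    · simp [Pi.single_apply, apply_ite, ite_mul]
    · exact Finset.sum_congr rfl fun j _ => by ring

/-- Minimality argument: differentiating an algebraic relation between `ρ` and the `x j` removes
the `x j`, provided `ρ` is a constant for enough derivations. -/
theorem isAlgebraic_of_derivations {k L : Type*} [Field k] [CharZero k] [Field L] [Algebra k L]
    {n : ℕ} (x : Fin n → L) (ρ : L) (D : Fin n → Derivation k L L)
    (hρ : ∀ j, D j ρ = 0) (hne : ∀ j, D j (x j) ≠ 0) (hx : ∀ j i, i ≠ j → D j (x i) = 0)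
    (G : MvPolynomial (Fin (n + 1)) k) (hG : G ≠ 0)
    (h : aeval (Fin.cons ρ x : Fin (n + 1) → L) G = 0) : IsAlgebraic k ρ := by
  induction hd : G.totalDegree using Nat.strong_induction_on generalizing G with
  | _ d ih =>
  subst hd
  by_cases hex : ∃ j : Fin n, pderiv j.succ G ≠ 0
  · obtain ⟨j, hj⟩ := hex
    refine ih _ (totalDegree_pderiv_lt hj) _ hj ?_ rfl
    have hD := derivation_aeval (D j) (Fin.cons ρ x : Fin (n + 1) → L) G
    rw [h, map_zero, Fin.sum_univ_succ, Finset.sum_eq_single j] at hD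
    · simpa [hρ, hne] using hD
    · intro i _ hi
      simp [hx j i hi]
    · simp
  · push Not at hex
    obtain ⟨q, rfl⟩ := exists_rename_eq_of_vars_subset_range G (fun _ : Unit => (0 : Fin (n + 1)))
      (Function.injective_of_subsingleton _) (by
        intro i hi
        induction i using Fin.cases with
        | zero => exact ⟨(), rfl⟩
        | succ j => exact absurd hi (pderiv_eq_zero_iff.1 (hex j)))
    refine ⟨uniqueAlgEquiv k Unit q, ?_, ?_⟩
    · rintro h0
      exact hG (by rw [(EmbeddingLike.map_eq_zero_iff).1 h0, map_zero])
    · rw [aeval_rename] at h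
      rw [← h]
      have : ((Polynomial.aeval ρ).comp (uniqueAlgEquiv k Unit).toAlgHom : MvPolynomial Unit k →ₐ[k] L)
          = aeval ((Fin.cons ρ x : Fin (n + 1) → L) ∘ fun _ => 0) := by
        ext; simp
      exact DFunLike.congr_fun this q

theorem exists_relation {k L : Type*} [Field k] [Field L] [Algebra k L] {n : ℕ}
    (x : Fin (n + 1) → L) (Q : MvPolynomial (Fin (n + 1)) k) (hQ : Q ≠ 0) (hxQ : aeval x Q = 0)
    (f g : MvPolynomial (Fin (n + 1)) k) :
    ∃ G : MvPolynomial (Fin (n + 1)) k, G ≠ 0 ∧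
      aeval (Fin.cons (aeval x f / aeval x g) (Fin.tail x) : Fin (n + 1) → L) G = 0 := by
  let _ : Algebra (MvPolynomial (Fin n) k) L := (aeval (Fin.tail x)).toAlgebra
  have hmap : ∀ p, algebraMap (MvPolynomial (Fin n) k) L p = aeval (Fin.tail x) p := fun _ => rfl
  have hev : ∀ (y : L) (p : MvPolynomial (Fin (n + 1)) k),
      Polynomial.aeval y (finSuccEquiv k n p) =
        aeval (Fin.cons y (Fin.tail x) : Fin (n + 1) → L) p := by
    intro y p
    induction p using MvPolynomial.induction_on with
    | C a => simp [hmap, finSuccEquiv_apply]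
    | add p q hp hq => simp [hp, hq]
    | mul_X p i hp =>
      simp only [map_mul, hp]
      induction i using Fin.cases with
      | zero => simp [finSuccEquiv_X_zero]
      | succ j => simp [finSuccEquiv_X_succ, hmap]
  have hzero : IsAlgebraic (MvPolynomial (Fin n) k) (x 0) :=
    ⟨finSuccEquiv k n Q, by simpa using hQ, by rw [hev, Fin.cons_self_tail, hxQ]⟩
  have halg : ∀ p : MvPolynomial (Fin (n + 1)) k, IsAlgebraic (MvPolynomial (Fin n) k) (aeval x p) := by
    intro p
    induction p using MvPolynomial.induction_on with
    | C a =>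
      have := isAlgebraic_algebraMap (A := L) (C a : MvPolynomial (Fin n) k)
      simpa [hmap] using this
    | add p q hp hq => simpa using hp.add hq
    | mul_X p i hp =>
      rw [map_mul, aeval_X]
      refine hp.mul ?_
      induction i using Fin.cases with
      | zero => exact hzero
      | succ j =>
        have := isAlgebraic_algebraMap (A := L) (X j : MvPolynomial (Fin n) k)
        simpa [hmap, Fin.tail] using this
  obtain ⟨p, hp, hp0⟩ := (halg f).mul (halg g).inv
  refine ⟨(finSuccEquiv k n).symm p, by simpa using hp, ?_⟩
  rw [← hev, AlgEquiv.apply_symm_apply, div_eq_mul_inv, hp0]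

/-- A derivation of a domain extends to its fraction field. -/
theorem exists_derivation_extension {k R L : Type*} [CommRing k] [CommRing R] [IsDomain R]
    [Algebra k R] [Field L] [Algebra k L] [Algebra R L] [IsScalarTower k R L] [IsFractionRing R L]
    (d : Derivation k R R) :
    ∃ D : Derivation k L L, ∀ r, D (algebraMap R L r) = algebraMap R L (d r) := by
  have := Algebra.FormallyEtale.of_isLocalization (Rₘ := L) (nonZeroDivisors R)
  let e := KaehlerDifferential.tensorKaehlerEquivOfFormallyEtale k R L
  let l : KaehlerDifferential k R →ₗ[R] L := (Algebra.linearMap R L).comp d.liftKaehlerDifferential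
  refine ⟨((l.liftBaseChange L).comp e.symm.toLinearMap).compDer (KaehlerDifferential.D k L), ?_⟩
  intro r
  simp [e, l, KaehlerDifferential.tensorKaehlerEquivOfFormallyEtale_symm_D_algebraMap]

theorem pderiv_comm {σ R : Type*} [CommRing R] (i j : σ) (p : MvPolynomial σ R) :
    pderiv i (pderiv j p) = pderiv j (pderiv i p) := by
  classical
  have h : ⁅pderiv (R := R) i, pderiv (R := R) j⁆ = 0 := by
    refine derivation_ext fun l => ?_
    simp [Derivation.commutator_apply, pderiv_X, Pi.single_apply, apply_ite]
  simpa [Derivation.commutator_apply, sub_eq_zero] using DFunLike.congr_fun h p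

theorem degreeOf_eq_zero_iff_notMem_vars {σ R : Type*} [CommSemiring R] {i : σ}
    {p : MvPolynomial σ R} : degreeOf i p = 0 ↔ i ∉ p.vars := by
  rw [← Nat.le_zero, degreeOf_le_iff]
  simp [mem_vars_iff_mem_support]

theorem not_dvd_pderiv {σ k : Type*} [Field k] [CharZero k] {i : σ} {Q : MvPolynomial σ k}
    (hQ : pderiv i Q ≠ 0) : ¬ Q ∣ pderiv i Q := by
  rintro ⟨g, hg⟩
  have hQ0 : Q ≠ 0 := by rintro rfl; simp at hQ
  have hg0 : g ≠ 0 := by rintro rfl; exact hQ (by rw [hg, mul_zero])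
  have h1 := degreeOf_pderiv_self_le i Q
  rw [hg, degreeOf_mul_eq hQ0 hg0] at h1
  have h2 : degreeOf i Q = 0 := by omega
  exact hQ (pderiv_eq_zero_iff.2 ((degreeOf_eq_zero_iff_notMem_vars).1 h2))

/-- The residue along the component `Q` of a closed form with denominator `Q * H` is constant. -/
theorem exists_residue {k : Type*} [Field k] [IsAlgClosed k] [CharZero k] {n : ℕ}
    {P Q H : MvPolynomial (Fin (n + 1)) k} (hP : P = Q * H) (hQ : Prime Q)
    (hQ0 : pderiv 0 Q ≠ 0) (hH : ¬ Q ∣ H) (A : Fin (n + 1) → MvPolynomial (Fin (n + 1)) k)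
    (hA : ∀ j : Fin n, P * (pderiv 0 (A j.succ) - pderiv j.succ (A 0)) =
      A j.succ * pderiv 0 P - A 0 * pderiv j.succ P) :
    ∃ c : k, Q ∣ A 0 - C c * pderiv 0 P := by
  let S := MvPolynomial (Fin (n + 1)) k
  let I : Ideal S := Ideal.span {Q}
  have hI : I.IsPrime := (Ideal.span_singleton_prime hQ.ne_zero).2 hQ
  let π : S →ₐ[k] S ⧸ I := Ideal.Quotient.mkₐ k I
  have hπ0 : ∀ f : MvPolynomial (Fin (n + 1)) k, π f = 0 ↔ Q ∣ f := fun f =>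
    Ideal.Quotient.eq_zero_iff_mem.trans Ideal.mem_span_singleton
  have hπs : Function.Surjective π := Ideal.Quotient.mkₐ_surjective k I
  let L := FractionRing (S ⧸ I)
  let d : Fin n → Derivation k S S := fun j =>
    pderiv 0 P • pderiv j.succ - pderiv j.succ P • pderiv 0
  have hd : ∀ (j : Fin n) (f : MvPolynomial (Fin (n + 1)) k),
      d j f = pderiv 0 P * pderiv j.succ f - pderiv j.succ P * pderiv 0 f := fun _ _ => rfl
  have hdπ : ∀ j f, π f = 0 → π (d j f) = 0 := by
    intro j f hf
    obtain ⟨g, rfl⟩ := (hπ0 f).1 hf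
    rw [hπ0, hd, hP]
    simp only [pderiv_mul]
    exact ⟨(pderiv 0 Q * H + Q * pderiv 0 H) * pderiv j.succ g + pderiv 0 H * pderiv j.succ Q * g
      - (pderiv j.succ Q * H + Q * pderiv j.succ H) * pderiv 0 g
      - pderiv j.succ H * pderiv 0 Q * g, by ring⟩
  choose D hD using fun j => exists_derivation_extension (L := L)
    (Derivation.liftOfSurjective hπs (hdπ j))
  let φ : S →ₐ[k] L := (IsScalarTower.toAlgHom k (S ⧸ I) L).comp π
  have hφ0 : ∀ f : MvPolynomial (Fin (n + 1)) k, φ f = 0 ↔ Q ∣ f := fun f => by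
    rw [← hπ0]
    exact map_eq_zero_iff (algebraMap (S ⧸ I) L) (IsFractionRing.injective _ _)
  have hDφ : ∀ j f, D j (φ f) = φ (d j f) := fun j f => by
    change D j (algebraMap _ L (π f)) = algebraMap _ L (π (d j f))
    rw [hD, Derivation.liftOfSurjective_apply]
  have hφX : ∀ f : MvPolynomial (Fin (n + 1)) k, aeval (fun i => φ (X i)) f = φ f := fun f =>
    (DFunLike.congr_fun (aeval_unique φ) f).symm
  have hφP : φ P = 0 := (hφ0 P).2 ⟨H, hP⟩
  have hb : φ (pderiv 0 P) ≠ 0 := by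
    rw [Ne, hφ0, hP, pderiv_mul, dvd_add_left (dvd_mul_right _ _)]
    exact fun h => (hQ.dvd_or_dvd h).elim (not_dvd_pderiv hQ0) hH
  have hrel : ∀ j, φ (d j (A 0)) * φ (pderiv 0 P) = φ (A 0) * φ (d j (pderiv 0 P)) := by
    intro j
    have h1 := congrArg φ (hA j)
    have h2 := congrArg (fun f => φ (pderiv 0 f)) (hA j)
    rw [hd, hd, pderiv_comm j.succ 0 P]
    simp only [map_sub, pderiv_mul] at h2
    simp only [map_mul, map_sub, map_add, hφP] at h1 h2 ⊢
    linear_combination (-φ (pderiv 0 P)) * h2 + φ (pderiv 0 (pderiv 0 P)) * h1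
  have hρ : ∀ j, D j (φ (A 0) / φ (pderiv 0 P)) = 0 := by
    intro j
    have h := congrArg (D j) (div_mul_cancel₀ (φ (A 0)) hb)
    rw [Derivation.leibniz, hDφ, hDφ, smul_eq_mul, smul_eq_mul] at h
    refine (mul_eq_zero.1 (?_ : φ (pderiv 0 P) * _ = 0)).resolve_left hb
    have h3 : φ (A 0) / φ (pderiv 0 P) * φ (d j (pderiv 0 P)) = φ (d j (A 0)) := by
      rw [div_mul_eq_mul_div, ← hrel j, mul_div_cancel_right₀ _ hb]
    linear_combination h - h3
  obtain ⟨G, hG, hG0⟩ := exists_relation (fun i => φ (X i)) Q hQ.ne_zero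
    (by rw [hφX, hφ0]) (A 0) (pderiv 0 P)
  rw [hφX, hφX] at hG0
  have halg := isAlgebraic_of_derivations (Fin.tail fun i => φ (X i)) _ D hρ
    (fun j => by simpa [Fin.tail, hDφ, hd] using hb)
    (fun j i hij => by simp [Fin.tail, hDφ, hd, hij]) G hG hG0
  obtain ⟨c, hc⟩ := minpoly.mem_range_of_degree_eq_one k _
    (IsAlgClosed.degree_eq_one_of_irreducible k (minpoly.irreducible halg.isIntegral))
  refine ⟨c, (hφ0 _).1 ?_⟩
  rw [eq_div_iff hb] at hc
  rw [map_sub, map_mul, ← hc, ← algebraMap_eq, AlgHom.commutes, sub_self]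

/-- A factor of a generic polynomial involves the first variable. -/
theorem pderiv_zero_ne_zero {n : ℕ} {P Q : MvPolynomial (Fin (n + 1)) ℂ} (hgen : IsX1Generic n P)
    (hQP : Q ∣ P) (hQ : Irreducible Q) : pderiv 0 Q ≠ 0 := by
  intro h0
  obtain ⟨q, rfl⟩ := exists_rename_eq_of_vars_subset_range Q (Fin.succ : Fin n → Fin (n + 1))
    (Fin.succ_injective n) (by
      intro i hi
      induction i using Fin.cases with
      | zero => exact absurd hi (pderiv_eq_zero_iff.1 h0)
      | succ j => exact ⟨j, rfl⟩)
  have hq : ¬ IsUnit q := fun h => hQ.not_isUnit (h.map (rename Fin.succ))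
  obtain ⟨M, hM, hqM⟩ := exists_max_ideal_of_mem_nonunits hq
  obtain ⟨b, rfl⟩ := (isMaximal_iff_eq_vanishingIdeal_singleton (K := ℂ)).1 hM
  rw [mem_vanishingIdeal_singleton_iff] at hqM
  obtain ⟨g, rfl⟩ := hQP
  refine Set.infinite_univ ((hgen b).subset fun t _ => ?_)
  have : eval b q = 0 := by simpa [aeval_eq_eval] using hqM
  simp [eval_rename, this]

/-- The tuple of coefficients of the logarithmic differential `dQ / Q`, written over the common
denominator `Q * H`. -/
theorem mul_pderiv_mem_ruppertGaoSpace {n : ℕ} {P Q H : MvPolynomial (Fin n) ℂ}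
    (hP : P = H * Q) (hP0 : P ≠ 0) : (fun j => H * pderiv j Q) ∈ ruppertGaoSpace n P := by
  subst hP
  have hH0 := left_ne_zero_of_mul hP0
  have hQ0 := right_ne_zero_of_mul hP0
  refine ⟨fun i j _ => ?_, fun i => ?_, fun i j _ => ?_⟩
  · simp only [pderiv_mul, pderiv_comm j i Q]
    ring
  · by_cases hi : pderiv i Q = 0
    · simp [hi]
    · have h1 := degreeOf_pderiv_self_le i Q
      have h2 : degreeOf i Q ≠ 0 := fun h =>
        hi (pderiv_eq_zero_iff.2 (degreeOf_eq_zero_iff_notMem_vars.1 h))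
      have h3 := degreeOf_mul_le i H (pderiv i Q)
      rw [degreeOf_mul_eq hH0 hQ0]
      exact h3.trans (by omega)
  · rw [degreeOf_mul_eq hH0 hQ0]
    exact (degreeOf_mul_le _ _ _).trans (Nat.add_le_add_left (degreeOf_pderiv_le i j Q) _)

end RuppertGao

open RuppertGao in
/-- for a reduced (squarefree) `X_1`-generic polynomial
`P = P_1 ⋯ P_s ∈ ℂ[X_1,…,X_{n+1}]` with `s` distinct irreducible factors, the
image `Ē(P)` of `E(P) = pr_1(F(P))` in the quotient ring
`Q(P) = ℂ[X_1,…,X_{n+1}]/(P)` has dimension exactly `s` over `ℂ`. -/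
theorem dim_Ebar_eq_card_factors
    (n : ℕ) (P : MvPolynomial (Fin (n + 1)) ℂ) (s : ℕ)
    (Q : Fin s → MvPolynomial (Fin (n + 1)) ℂ)
    (hfac : P = ∏ i, Q i) (hirr : ∀ i, Irreducible (Q i))
    (hdist : ∀ i j, i ≠ j → ¬ Associated (Q i) (Q j))
    (hgen : IsX1Generic n P) :
    Module.finrank ℂ
      (Submodule.map ((Ideal.Quotient.mkₐ ℂ (Ideal.span {P})).toLinearMap)
        (Submodule.map (LinearMap.proj 0) (ruppertGaoSpace (n + 1) P))) = s := by
  classical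
  have hprime : ∀ i, Prime (Q i) := fun i => (hirr i).prime
  have hP0 : P ≠ 0 := hfac ▸ Finset.prod_ne_zero_iff.2 fun i _ => (hirr i).ne_zero
  let H : Fin s → MvPolynomial (Fin (n + 1)) ℂ := fun i => ∏ j ∈ Finset.univ.erase i, Q j
  have hH : ∀ i, P = H i * Q i := fun i => by
    rw [hfac, Finset.prod_erase_mul _ _ (Finset.mem_univ i)]
  have hQH : ∀ i, ¬ Q i ∣ H i := fun i h => by
    obtain ⟨j, hj, hij⟩ := (hprime i).exists_mem_finset_dvd h
    exact hdist i j (Finset.ne_of_mem_erase hj).symm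
      ((hirr i).associated_of_dvd (hirr j) hij)
  have hQHne : ∀ i j, i ≠ j → Q i ∣ H j := fun i j hij =>
    Finset.dvd_prod_of_mem _ (Finset.mem_erase.2 ⟨hij, Finset.mem_univ i⟩)
  have hQP : ∀ i, Q i ∣ P := fun i => ⟨H i, by rw [hH i, mul_comm]⟩
  have hpd : ∀ i, pderiv 0 (Q i) ≠ 0 := fun i => pderiv_zero_ne_zero hgen (hQP i) (hirr i)
  let B : Fin s → MvPolynomial (Fin (n + 1)) ℂ := fun i => H i * pderiv 0 (Q i)
  have hsum : ∀ (c : Fin s → ℂ) (i : Fin s), Q i ∣ (∑ j, C (c j) * B j) - C (c i) * B i := by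
    intro c i
    rw [← Finset.add_sum_erase _ _ (Finset.mem_univ i), add_sub_cancel_left]
    exact Finset.dvd_sum fun j hj =>
      ((hQHne i j (Finset.ne_of_mem_erase hj).symm).mul_right _).mul_left _
  set q := (Ideal.Quotient.mkₐ ℂ (Ideal.span {P})).toLinearMap
  have hq0 : ∀ f, q f = 0 ↔ P ∣ f := fun f =>
    Ideal.Quotient.eq_zero_iff_mem.trans Ideal.mem_span_singleton
  have hqs : ∀ c : Fin s → ℂ, ∑ j, c j • q (B j) = q (∑ j, C (c j) * B j) := fun c => by
    simp only [map_sum, ← smul_eq_C_mul, map_smul]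
  have hli : LinearIndependent ℂ (fun i => q (B i)) := by
    refine Fintype.linearIndependent_iff.2 fun c hc i => ?_
    by_contra hci
    rw [hqs, hq0] at hc
    have h1 := (dvd_sub_right ((hQP i).trans hc)).1 (hsum c i)
    rw [← smul_eq_C_mul] at h1
    have h2 : Q i ∣ B i := by
      have := (h1.mul_left (C (c i)⁻¹))
      rwa [← smul_eq_C_mul, inv_smul_smul₀ hci] at this
    exact ((hprime i).dvd_or_dvd h2).elim (hQH i) (not_dvd_pderiv (hpd i))
  have hspan : Submodule.map q (Submodule.map (LinearMap.proj 0) (ruppertGaoSpace (n + 1) P)) =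
      Submodule.span ℂ (Set.range fun i => q (B i)) := by
    apply le_antisymm
    · rintro _ ⟨_, ⟨A, hA, rfl⟩, rfl⟩
      choose c hc using fun i => exists_residue ((hH i).trans (mul_comm _ _)) (hprime i) (hpd i)
        (hQH i) A fun j => hA.1 0 j.succ j.succ_pos
      have hdvd : P ∣ A 0 - ∑ j, C (c j) * B j := by
        rw [hfac]
        refine Fintype.prod_dvd_of_isRelPrime (fun i j hij => ?_) fun i => ?_
        · exact (hirr i).isRelPrime_iff_not_dvd.2 fun h =>
            hdist i j hij ((hirr i).associated_of_dvd (hirr j) h)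
        · have h1 : Q i ∣ C (c i) * pderiv 0 P - C (c i) * B i := by
            rw [hH i, pderiv_mul, ← mul_sub, add_sub_cancel_right]
            exact (dvd_mul_left _ _).mul_left _
          have h2 := dvd_sub (dvd_add (hc i) h1) (hsum c i)
          convert h2 using 1
          ring
      have heq : q (A 0) = ∑ j, c j • q (B j) := by
        rw [hqs, ← sub_eq_zero, ← map_sub, hq0]
        exact hdvd
      change q (A 0) ∈ _
      rw [heq]
      exact Submodule.sum_mem _ fun i _ =>
        Submodule.smul_mem _ _ (Submodule.subset_span ⟨i, rfl⟩)
    · rw [Submodule.span_le]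
      rintro _ ⟨i, rfl⟩
      exact ⟨_, ⟨_, mul_pderiv_mem_ruppertGaoSpace (hH i) hP0, rfl⟩, rfl⟩
  rw [hspan, finrank_span_eq_card hli, Fintype.card_fin]
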